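/- arXiv:1308.3506 — 2 statements merged into one kernel-verified Lean document; each statement's English description precedes it below -/
import Mathlib

section
/- Let 𝒦 ⊆ ℝ^d be a convex set containing 0 whose intrinsic (relative) interior is nonempty, let σ, σ̂ be probability distributions on 𝒜, let f be a deviation with regret features r(f,·), and let Φ_f be a finite nonempty set of deviations. Then the following are equivalent: (i) for every w ∈ 𝒦, ⟨r(f,σ̂), w⟩ ≤ max_{g∈Φ_f} ⟨r(g,σ), w⟩; (ii) there exists a probability distribution η on Φ_f such that r(f,σ̂) − Σ_{g∈Φ_f} η(g) r(g,σ) ∈ −𝒦*, where 𝒦* = {x ∈ ℝ^d : ⟨x,y⟩ ≥ 0 for all y ∈ 𝒦} is the dual cone of 𝒦. -/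
open scoped BigOperators

/-- Dot product on `ℝ^d`. -/
def dot {d : ℕ} (x w : Fin d → ℝ) : ℝ := ∑ k, x k * w k

/-- `σ` is a probability distribution on the finite set `A`. -/
def IsProb {A : Type} [Fintype A] (σ : A → ℝ) : Prop :=
  (∀ a, 0 ≤ σ a) ∧ ∑ a, σ a = 1

/-- Expected regret features of deviation `f` under distribution `σ`. -/
def expFeat {d : ℕ} {A Φ : Type} [Fintype A] (r : Φ → A → Fin d → ℝ)
    (σ : A → ℝ) (f : Φ) : Fin d → ℝ := ∑ a, σ a • r f a

/-- The dual cone `𝒦* = {x : ⟨x,y⟩ ≥ 0 for all y ∈ 𝒦}`. -/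
def dualCone {d : ℕ} (K : Set (Fin d → ℝ)) : Set (Fin d → ℝ) :=
  {x | ∀ y ∈ K, 0 ≤ dot x y}

theorem dot_aux {d : ℕ} {ι : Type} [Fintype ι] (x y : Fin d → ℝ) (b : ι → Fin d → ℝ)
    (η : ι → ℝ) (hη : ∑ g, η g = 1) :
    dot (-(x - ∑ g, η g • b g)) y = ∑ g, η g * dot (b g) y - dot x y := by
  unfold dot
  simp only [Pi.neg_apply, Pi.sub_apply, Finset.sum_apply, Pi.smul_apply, smul_eq_mul,
    Finset.mul_sum]
  rw [Finset.sum_comm, ← Finset.sum_sub_distrib]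
  refine Finset.sum_congr rfl fun k _ => ?_
  rw [neg_sub, sub_mul, Finset.sum_mul]
  simp only [mul_assoc]

theorem gordan_aux {d : ℕ} {ι : Type} [Fintype ι] [Nonempty ι]
    (K : Set (Fin d → ℝ)) (hKconv : Convex ℝ K) (hK0 : (0 : Fin d → ℝ) ∈ K)
    (L : (Fin d → ℝ) →ₗ[ℝ] (ι → ℝ)) (h : ∀ w ∈ K, ∃ g, L w g ≤ 0) :
    ∃ η : ι → ℝ, (∀ g, 0 ≤ η g) ∧ (∑ g, η g = 1) ∧ ∀ w ∈ K, ∑ g, η g * L w g ≤ 0 := by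
  classical
  let P : Set (ι → ℝ) := Set.univ.pi fun _ => Set.Ioi 0
  have hP : IsOpen P := isOpen_set_pi Set.finite_univ fun _ _ => isOpen_Ioi
  have hPc : Convex ℝ P := convex_pi fun _ _ => convex_Ioi 0
  have hdis : Disjoint P (L '' K) := by
    rw [Set.disjoint_left]
    rintro _ hp ⟨w, hw, rfl⟩
    obtain ⟨g, hg⟩ := h w hw
    exact absurd (hp g (Set.mem_univ g)) (not_lt.2 hg)
  obtain ⟨f, u, hfP, hfS⟩ := geometric_hahn_banach_open hPc hP (hKconv.linear_image L) hdis
  have hu0 : u ≤ 0 := by simpa using hfS (L 0) ⟨0, hK0, rfl⟩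
  have h1 : f 1 < 0 := lt_of_lt_of_le (hfP 1 (fun _ _ => by simp)) hu0
  have hu : 0 ≤ u := by
    by_contra hu
    push Not at hu
    have ht : 0 < u / f 1 := div_pos_of_neg_of_neg hu h1
    have := hfP ((u / f 1) • (1 : ι → ℝ)) (fun _ _ => by simpa using ht)
    rw [map_smul, smul_eq_mul, div_mul_cancel₀ _ h1.ne] at this
    exact lt_irrefl _ this
  have hs : ∀ g, f (Pi.single g 1) ≤ 0 := by
    intro g
    by_contra hc
    push Not at hc
    have ht : 0 < -f 1 / f (Pi.single g 1) := div_pos (by linarith) hc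
    have := hfP (1 + (-f 1 / f (Pi.single g 1)) • (Pi.single g (1 : ℝ))) (fun j _ => by
      have : (0 : ℝ) ≤ (Pi.single g (1 : ℝ) : ι → ℝ) j := by
        by_cases hj : j = g
        · subst hj; simp
        · simp [hj]
      have := mul_nonneg ht.le this
      simp only [Set.mem_Ioi, Pi.add_apply, Pi.one_apply, Pi.smul_apply, smul_eq_mul]
      linarith)
    rw [map_add, map_smul, smul_eq_mul, div_mul_cancel₀ _ hc.ne'] at this
    linarith
  have hf : ∀ v : ι → ℝ, f v = ∑ g, f (Pi.single g 1) * v g := by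
    intro v
    conv_lhs => rw [pi_eq_sum_univ' v]
    rw [map_sum]
    refine Finset.sum_congr rfl fun g _ => ?_
    rw [map_smul, smul_eq_mul, mul_comm]
  refine ⟨fun g => f (Pi.single g 1) / f 1, fun g => div_nonneg_of_nonpos (hs g) h1.le, ?_, ?_⟩
  · rw [← Finset.sum_div, div_eq_one_iff_eq h1.ne, hf 1]
    simp
  · intro w hw
    have h2 : 0 ≤ f (L w) := hu.trans (hfS _ ⟨w, hw, rfl⟩)
    have : ∑ g, f (Pi.single g 1) / f 1 * L w g = f (L w) / f 1 := by
      rw [hf (L w), Finset.sum_div]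
      exact Finset.sum_congr rfl fun g _ => by ring
    rw [this]
    exact div_nonpos_of_nonneg_of_nonpos h2 h1.le

/-- Lemma on a single deviation: the regret of `f` under `σ̂` is dominated by the
maximal regret over `Φ_f` under `σ` for every `w ∈ 𝒦` iff the regret features of
`f` differ from a convex combination of regret features over `Φ_f` by an element
of `-𝒦*`. -/
theorem K_ICE_single_deviation
    {d : ℕ} {A : Type} [Fintype A] [Nonempty A] {Φf : Type} [Fintype Φf] [Nonempty Φf]
    (K : Set (Fin d → ℝ)) (hKconv : Convex ℝ K) (hK0 : (0 : Fin d → ℝ) ∈ K)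
    (hKri : (intrinsicInterior ℝ K).Nonempty)
    (σ σhat : A → ℝ) (hσ : IsProb σ) (hσhat : IsProb σhat)
    (rf : A → Fin d → ℝ) (rg : Φf → A → Fin d → ℝ) :
    (∀ w ∈ K, dot (expFeat (fun _ : Unit => rf) σhat ()) w ≤
        ⨆ g : Φf, dot (expFeat rg σ g) w) ↔
      (∃ η : Φf → ℝ, (∀ g, 0 ≤ η g) ∧ (∑ g, η g = 1) ∧
        (expFeat (fun _ : Unit => rf) σhat () - ∑ g, η g • expFeat rg σ g) ∈
          -dualCone K) := by
  generalize expFeat (fun _ : Unit => rf) σhat () = x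
  generalize expFeat rg σ = b
  constructor
  · intro h
    let L : (Fin d → ℝ) →ₗ[ℝ] (Φf → ℝ) :=
      { toFun := fun w g => dot x w - dot (b g) w
        map_add' := fun v w => by
          ext g
          simp only [dot, Pi.add_apply, mul_add, Finset.sum_add_distrib]
          ring
        map_smul' := fun c w => by
          ext g
          simp only [dot, Pi.smul_apply, smul_eq_mul, RingHom.id_apply, mul_sub, Finset.mul_sum]
          congr 1 <;> exact Finset.sum_congr rfl fun k _ => by ring }
    obtain ⟨η, h0, h1, h2⟩ := gordan_aux K hKconv hK0 L (fun w hw => by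
      obtain ⟨g, hg⟩ := exists_eq_ciSup_of_finite (f := fun g => dot (b g) w)
      have := h w hw
      refine ⟨g, ?_⟩
      change dot x w - dot (b g) w ≤ 0
      linarith)
    refine ⟨η, h0, h1, fun w hw => ?_⟩
    rw [dot_aux x w b η h1]
    have h3 : ∑ g, η g * (dot x w - dot (b g) w) ≤ 0 := h2 w hw
    simp only [mul_sub, Finset.sum_sub_distrib, ← Finset.sum_mul, h1] at h3
    linarith
  · rintro ⟨η, h0, h1, h2⟩ w hw
    have h3 := h2 w hw
    rw [dot_aux x w b η h1] at h3
    have h4 : ∑ g, η g * dot (b g) w ≤ ∑ g, η g * ⨆ g, dot (b g) w :=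
      Finset.sum_le_sum fun g _ => mul_le_mul_of_nonneg_left
        (le_ciSup (f := fun g => dot (b g) w) (Set.finite_range _).bddAbove g) (h0 g)
    rw [← Finset.sum_mul, h1] at h4
    linarith
end

section
/- Let 𝒦 ⊆ ℝ^d be a convex set containing 0 whose intrinsic (relative) interior is nonempty, and let σ, σ̂ be probability distributions on 𝒜. Then σ̂ is 𝒦-strongly rational with respect to Φ relative to σ (i.e., for all w ∈ 𝒦, Regret_Φ(σ̂|w) ≤ Regret_Φ(σ|w)) if and only if σ̂ satisfies the 𝒦-ICE polytope relative to σ: for every f ∈ Φ there exists a probability distribution η_f on Φ such that r(f,σ̂) − Σ_{g∈Φ} η_f(g) r(g,σ) ∈ −𝒦*, where 𝒦* = {x ∈ ℝ^d : ⟨x,y⟩ ≥ 0 for all y ∈ 𝒦} is the dual cone of 𝒦. -/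
open scoped BigOperators

/-- `Regret_Φ(σ|w) = max_{f ∈ Φ} ⟨r(f,σ), w⟩`. -/
noncomputable def Regret {d : ℕ} {A Φ : Type} [Fintype A] [Fintype Φ] [Nonempty Φ]
    (r : Φ → A → Fin d → ℝ) (σ : A → ℝ) (w : Fin d → ℝ) : ℝ :=
  ⨆ f : Φ, dot (expFeat r σ f) w

lemma dot_add_smul {d : ℕ} (x y z : Fin d → ℝ) (a b : ℝ) :
    dot x (a • y + b • z) = a * dot x y + b * dot x z := by
  simp only [dot, Pi.add_apply, Pi.smul_apply, smul_eq_mul, Finset.mul_sum,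
    ← Finset.sum_add_distrib]
  exact Finset.sum_congr rfl fun k _ => by ring

lemma dot_neg_left {d : ℕ} (x w : Fin d → ℝ) : dot (-x) w = - dot x w := by
  simp [dot]

lemma dot_sub_sum {d : ℕ} {Φ : Type} [Fintype Φ] (c : Fin d → ℝ) (b : Φ → Fin d → ℝ)
    (η : Φ → ℝ) (w : Fin d → ℝ) :
    dot (c - ∑ g, η g • b g) w = dot c w - ∑ g, η g * dot (b g) w := by
  simp only [dot, Pi.sub_apply, Finset.sum_apply, Pi.smul_apply, smul_eq_mul, sub_mul,
    Finset.sum_sub_distrib, Finset.sum_mul, Finset.mul_sum]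
  rw [Finset.sum_comm]
  simp only [mul_assoc]

lemma exists_mix {d : ℕ} {Φ : Type} [Fintype Φ] [Nonempty Φ]
    (K : Set (Fin d → ℝ)) (hK : Convex ℝ K) (c : Fin d → ℝ) (b : Φ → Fin d → ℝ)
    (h : ∀ w ∈ K, ∃ g, dot c w ≤ dot (b g) w) :
    ∃ η ∈ stdSimplex ℝ Φ, ∀ w ∈ K, dot c w - ∑ g, η g * dot (b g) w ≤ 0 := by
  classical
  let F : (Φ → ℝ) → (Fin d → ℝ) → ℝ := fun η w => dot c w - ∑ g, η g * dot (b g) w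
  have hneX : (stdSimplex ℝ Φ).Nonempty := ⟨_, single_mem_stdSimplex ℝ (Classical.arbitrary Φ)⟩
  have hc1 : ∀ w, Continuous fun η => F η w := by
    intro w
    fun_prop
  have hc2 : ∀ η, Continuous fun w => F η w := by
    intro η
    simp only [F, dot]
    fun_prop
  have hq1 : ∀ w ∈ K, QuasiconvexOn ℝ (stdSimplex ℝ Φ) fun η => F η w := by
    intro w _
    apply ConvexOn.quasiconvexOn
    refine ⟨convex_stdSimplex ℝ Φ, ?_⟩
    intro x _ y _ s t _ _ hst
    apply le_of_eq
    simp only [F, Pi.add_apply, Pi.smul_apply, smul_eq_mul, add_mul, Finset.sum_add_distrib,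
      mul_sub, Finset.mul_sum, mul_assoc]
    linear_combination (-dot c w) * hst
  have hq2 : ∀ η ∈ stdSimplex ℝ Φ, QuasiconcaveOn ℝ K fun w => F η w := by
    intro η _
    apply ConcaveOn.quasiconcaveOn
    refine ⟨hK, ?_⟩
    intro x _ y _ s t _ _ hst
    apply le_of_eq
    simp only [F, smul_eq_mul, dot_add_smul, mul_add, Finset.sum_add_distrib, mul_sub,
      Finset.mul_sum, mul_left_comm]
    ring
  have key := (isCompact_stdSimplex ℝ Φ).inter_iInter_nonempty
    (fun w : K => {η | F η w ≤ 0}) (fun w => isClosed_le (hc1 w) continuous_const) ?_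
  · obtain ⟨η, hη, hη'⟩ := key
    refine ⟨η, hη, fun w hw => ?_⟩
    exact Set.mem_iInter.1 hη' ⟨w, hw⟩
  intro u
  by_contra hcon
  obtain ⟨w, hw, hw'⟩ := Sion.exists_lt_iInf_of_lt_iInf_of_finite (f := F)
    (X := stdSimplex ℝ Φ) (Y := K) hneX (isCompact_stdSimplex ℝ Φ)
    (fun w _ => (hc1 w).lowerSemicontinuous.lowerSemicontinuousOn _) hq1 hK
    (fun η _ => (hc2 η).upperSemicontinuous.upperSemicontinuousOn _) hq2
    (convex_stdSimplex ℝ Φ) (s := Subtype.val '' (u : Set K)) (u.finite_toSet.image _)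
    (by rintro _ ⟨x, _, rfl⟩; exact x.2) (t := 0) (by
      intro η hη
      by_contra! hno
      refine hcon ⟨η, hη, ?_⟩
      simp only [Set.mem_iInter]
      exact fun i hi => hno i ⟨i, hi, rfl⟩)
  obtain ⟨g, hg⟩ := h w hw
  have := hw' _ (single_mem_stdSimplex ℝ g)
  simp [F, Pi.single_apply] at this
  linarith

/-- `σ̂` is `𝒦`-strongly rational w.r.t. `Φ` relative to `σ` iff `σ̂` satisfies the
`𝒦`-ICE polytope relative to `σ`. -/
theorem K_strongly_rational_iff_K_ICE
    {d : ℕ} {A Φ : Type} [Fintype A] [Nonempty A] [Fintype Φ] [Nonempty Φ]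
    (K : Set (Fin d → ℝ)) (hKconv : Convex ℝ K) (hK0 : (0 : Fin d → ℝ) ∈ K)
    (hKri : (intrinsicInterior ℝ K).Nonempty)
    (r : Φ → A → Fin d → ℝ) (σ σhat : A → ℝ)
    (hσ : IsProb σ) (hσhat : IsProb σhat) :
    (∀ w ∈ K, Regret r σhat w ≤ Regret r σ w) ↔
      (∀ f : Φ, ∃ η : Φ → ℝ, (∀ g, 0 ≤ η g) ∧ (∑ g, η g = 1) ∧
        (expFeat r σhat f - ∑ g, η g • expFeat r σ g) ∈ -dualCone K) := by
  constructor
  · intro h f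
    obtain ⟨η, hη, hw⟩ := exists_mix K hKconv (expFeat r σhat f) (expFeat r σ) (by
      intro w hw
      obtain ⟨g, hg⟩ := exists_eq_ciSup_of_finite (f := fun g => dot (expFeat r σ g) w)
      refine ⟨g, ?_⟩
      calc dot (expFeat r σhat f) w ≤ Regret r σhat w :=
            le_ciSup (f := fun g => dot (expFeat r σhat g) w) (Set.finite_range _).bddAbove f
        _ ≤ Regret r σ w := h w hw
        _ = _ := hg.symm)
    refine ⟨η, hη.1, hη.2, ?_⟩
    rw [Set.mem_neg]
    intro w hwK
    rw [dot_neg_left, dot_sub_sum]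
    linarith [hw w hwK]
  · intro h w hw
    apply ciSup_le
    intro f
    obtain ⟨η, h0, h1, h2⟩ := h f
    have h3 := h2 w hw
    rw [dot_neg_left, dot_sub_sum] at h3
    calc dot (expFeat r σhat f) w ≤ ∑ g, η g * dot (expFeat r σ g) w := by linarith
      _ ≤ ∑ g, η g * Regret r σ w := Finset.sum_le_sum fun g _ =>
          mul_le_mul_of_nonneg_left
            (le_ciSup (f := fun g => dot (expFeat r σ g) w) (Set.finite_range _).bddAbove g) (h0 g)
      _ = Regret r σ w := by rw [← Finset.sum_mul, h1, one_mul]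
end
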